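/- Consider the complete k-ary tree T with ℓ levels of nodes satisfying 2(ℓ−1)(k−1) − k > 0, true leaf counts x, and noisy counts h̃ = H(x) + η with η having i.i.d. coordinates distributed as Laplace with scale ℓ/ε. For a range query q, let H̃_q denote the estimate obtained by summing h̃ over the roots of the minimal collection of disjoint subtrees whose leaf intervals partition the query range, and let h̄_q denote the answer obtained by summing the minimum L2 consistent solution h̄ over the leaves in the range. Then there exists a range query q (namely, the sum of all leaves except the leftmost and rightmost ones) such that E[(h̄_q − q(x))²] ≤ (3/(2(ℓ−1)(k−1) − k)) · E[(H̃_q − q(x))²]; indeed for this q, E[(h̄_q − q(x))²] ≤ 6ℓ²/ε² while E[(H̃_q − q(x))²] = 2(2(k−1)(ℓ−1) − k)·ℓ²/ε². -/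

import Mathlib

open MeasureTheory

/-- A node of the complete `k`-ary tree with `ℓ` levels of nodes. -/
abbrev TreeNode (k ℓ : ℕ) : Type := Σ d : Fin ℓ, Fin (k ^ (d : ℕ))

/-- The node at depth `d` with index `j`. -/
def mkNode {k ℓ : ℕ} (d : ℕ) (hd : d < ℓ) (j : Fin (k ^ d)) : TreeNode k ℓ := ⟨⟨d, hd⟩, j⟩

/-- The `r`-th child of the node at depth `d` with index `j`. -/
def childNode {k ℓ : ℕ} (d : ℕ) (hd : d + 1 < ℓ) (j : Fin (k ^ d)) (r : Fin k) :
    TreeNode k ℓ :=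
  ⟨⟨d + 1, hd⟩, ⟨(j : ℕ) * k + (r : ℕ), by
    have hj := j.isLt
    have hr := r.isLt
    calc (j : ℕ) * k + (r : ℕ) < ((j : ℕ) + 1) * k := by nlinarith
      _ ≤ k ^ d * k := Nat.mul_le_mul_right _ (by omega)
      _ = k ^ (d + 1) := (pow_succ k d).symm⟩⟩

/-- A node-value vector is consistent if every internal node's value equals the sum of
its children's values. -/
def Consistent {k ℓ : ℕ} (t : TreeNode k ℓ → ℝ) : Prop :=
  ∀ (d : ℕ) (hd : d + 1 < ℓ) (j : Fin (k ^ d)),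
    t (mkNode d (by omega) j) = ∑ r : Fin k, t (childNode d hd j r)

/-- The leaves of the subtree rooted at `v`. -/
def subtreeLeaves {k ℓ : ℕ} (v : TreeNode k ℓ) : Finset (Fin (k ^ (ℓ - 1))) :=
  Finset.univ.filter fun u => (u : ℕ) / k ^ (ℓ - 1 - (v.1 : ℕ)) = (v.2 : ℕ)

/-- The consistent node counts induced by leaf counts `x`: `H(x)[v] = Σ_{u ∈ leaves(v)} x[u]`. -/
noncomputable def Hfun {k ℓ : ℕ} (x : Fin (k ^ (ℓ - 1)) → ℝ) (v : TreeNode k ℓ) : ℝ :=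
  ∑ u ∈ subtreeLeaves v, x u

/-- The Laplace measure on `ℝ` with scale `b`: density `x ↦ (1/(2b))·exp(−|x|/b)`. -/
noncomputable def laplaceMeasure (b : ℝ) : Measure ℝ :=
  volume.withDensity fun x => ENNReal.ofReal ((2 * b)⁻¹ * Real.exp (-|x| / b))

/-- I.i.d. Laplace noise with scale `b`, one coordinate for each node of the tree. -/
noncomputable def treeNoise (k ℓ : ℕ) (b : ℝ) : Measure (TreeNode k ℓ → ℝ) :=
  Measure.pi fun _ => laplaceMeasure b

/-- The absolute moments of the Laplace density. -/
lemma integral_abs_pow_mul_laplace_density {b : ℝ} (hb : 0 < b) (n : ℕ) :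
    ∫ x : ℝ, |x| ^ n * ((2 * b)⁻¹ * Real.exp (-|x| / b)) = n.factorial * b ^ n := by
  rw [integral_comp_abs (f := fun y => y ^ n * ((2 * b)⁻¹ * Real.exp (-y / b)))]
  have h := Real.integral_rpow_mul_exp_neg_mul_Ioi (a := n + 1) (r := b⁻¹)
    (by positivity) (by positivity)
  have h' : ∫ y in Set.Ioi (0 : ℝ), y ^ n * ((2 * b)⁻¹ * Real.exp (-y / b))
      = (2 * b)⁻¹ * ∫ y in Set.Ioi (0 : ℝ), y ^ ((n : ℝ) + 1 - 1) * Real.exp (-(b⁻¹ * y)) := by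
    rw [← integral_const_mul]
    refine integral_congr_ae (ae_of_all _ fun y => ?_)
    simp only [add_sub_cancel_right, Real.rpow_natCast]
    rw [show -y / b = -(b⁻¹ * y) by ring]
    ring
  rw [h', h, Real.Gamma_nat_eq_factorial, one_div, inv_inv,
    show ((n : ℝ) + 1) = ((n + 1 : ℕ) : ℝ) by push_cast; ring, Real.rpow_natCast]
  field_simp
  ring

lemma integrable_abs_pow_mul_laplace_density {b : ℝ} (hb : 0 < b) (n : ℕ) :
    Integrable fun x : ℝ => |x| ^ n * ((2 * b)⁻¹ * Real.exp (-|x| / b)) := by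
  by_contra h
  have := integral_abs_pow_mul_laplace_density hb n
  rw [integral_undef h] at this
  have : (0 : ℝ) < n.factorial * b ^ n := by positivity
  linarith

lemma isProbabilityMeasure_laplaceMeasure {b : ℝ} (hb : 0 < b) :
    IsProbabilityMeasure (laplaceMeasure b) := by
  constructor
  have hi := integrable_abs_pow_mul_laplace_density hb 0
  have h := integral_abs_pow_mul_laplace_density hb 0
  simp only [pow_zero, one_mul, Nat.factorial_zero, Nat.cast_one] at hi h
  rw [laplaceMeasure, withDensity_apply _ MeasurableSet.univ, Measure.restrict_univ,
    ← ofReal_integral_eq_lintegral_ofReal hi (ae_of_all _ fun x => by positivity), h,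
    ENNReal.ofReal_one]

lemma measurable_laplace_density (b : ℝ) :
    Measurable fun x : ℝ => ENNReal.ofReal ((2 * b)⁻¹ * Real.exp (-|x| / b)) := by
  fun_prop

lemma integral_laplaceMeasure {b : ℝ} (hb : 0 < b) (f : ℝ → ℝ) :
    ∫ x, f x ∂(laplaceMeasure b) = ∫ x, f x * ((2 * b)⁻¹ * Real.exp (-|x| / b)) := by
  rw [laplaceMeasure, integral_withDensity_eq_integral_toReal_smul (measurable_laplace_density b)
    (ae_of_all _ fun x => ENNReal.ofReal_lt_top)]
  refine integral_congr_ae (ae_of_all _ fun x => ?_)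
  simp only [smul_eq_mul]
  rw [ENNReal.toReal_ofReal (by positivity), mul_comm]

lemma memLp_id_laplaceMeasure {b : ℝ} (hb : 0 < b) :
    MemLp (fun x : ℝ => x) 2 (laplaceMeasure b) := by
  rw [memLp_two_iff_integrable_sq (by fun_prop), laplaceMeasure,
    integrable_withDensity_iff (measurable_laplace_density b)
      (ae_of_all _ fun x => ENNReal.ofReal_lt_top)]
  refine (integrable_abs_pow_mul_laplace_density hb 2).congr (ae_of_all _ fun x => ?_)
  simp only [sq_abs]
  rw [ENNReal.toReal_ofReal (by positivity)]

lemma integral_id_laplaceMeasure {b : ℝ} (hb : 0 < b) :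
    ∫ x, x ∂(laplaceMeasure b) = 0 := by
  rw [integral_laplaceMeasure hb]
  have h := integral_neg_eq_self (fun x : ℝ => x * ((2 * b)⁻¹ * Real.exp (-|x| / b))) volume
  simp only [abs_neg, neg_mul, integral_neg] at h
  linarith

lemma variance_laplaceMeasure {b : ℝ} (hb : 0 < b) :
    ProbabilityTheory.variance (fun x => x) (laplaceMeasure b) = 2 * b ^ 2 := by
  rw [ProbabilityTheory.variance_of_integral_eq_zero (by fun_prop)
    (integral_id_laplaceMeasure hb), integral_laplaceMeasure hb]
  have h := integral_abs_pow_mul_laplace_density hb 2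
  simp only [sq_abs] at h
  simpa using h

/-- The second moment of a linear form in i.i.d. Laplace noise. -/
lemma integral_sq_linear_treeNoise {k ℓ : ℕ} {b : ℝ} (hb : 0 < b) (c : TreeNode k ℓ → ℝ) :
    ∫ ω, (∑ v, c v * ω v) ^ 2 ∂(treeNoise k ℓ b) = 2 * b ^ 2 * ∑ v, c v ^ 2 := by
  have := isProbabilityMeasure_laplaceMeasure hb
  have hL : ∀ v, MemLp (fun y : ℝ => c v * y) 2 (laplaceMeasure b) :=
    fun v => (memLp_id_laplaceMeasure hb).const_mul (c v)
  have hv := ProbabilityTheory.variance_sum_pi (μ := fun _ : TreeNode k ℓ => laplaceMeasure b) hL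
  have hsum : (∑ v, fun ω : TreeNode k ℓ → ℝ => c v * ω v) = fun ω => ∑ v, c v * ω v := by
    ext ω; simp
  have hmean : ∫ ω, ∑ v, c v * ω v ∂(treeNoise k ℓ b) = 0 := by
    have hmp : ∀ v : TreeNode k ℓ, MeasurePreserving (fun ω : TreeNode k ℓ → ℝ => ω v)
        (treeNoise k ℓ b) (laplaceMeasure b) :=
      fun v => measurePreserving_eval (fun _ : TreeNode k ℓ => laplaceMeasure b) v
    rw [integral_finsetSum]
    · refine Finset.sum_eq_zero fun v _ => ?_
      have h0 : ∫ ω, ω v ∂(treeNoise k ℓ b) = ∫ y, y ∂(laplaceMeasure b) := by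
        rw [← (hmp v).map_eq, integral_map (measurable_pi_apply v).aemeasurable (by fun_prop)]
      rw [integral_const_mul, h0, integral_id_laplaceMeasure hb, mul_zero]
    · intro v _
      exact (hmp v).integrable_comp_of_integrable ((hL v).integrable one_le_two)
  rw [hsum] at hv
  rw [← ProbabilityTheory.variance_of_integral_eq_zero
    (Finset.measurable_fun_sum _ fun v _ =>
      by exact (measurable_pi_apply v).const_mul _).aemeasurable
    hmean, treeNoise, hv,
    Finset.mul_sum]
  refine Finset.sum_congr rfl fun v _ => ?_
  rw [ProbabilityTheory.variance_const_mul, variance_laplaceMeasure hb]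
  ring

lemma sum_fin_pow_succ {k d : ℕ} (F : ℕ → ℝ) :
    ∑ i : Fin (k ^ (d + 1)), F i = ∑ j : Fin (k ^ d), ∑ r : Fin k, F (j * k + r) := by
  rw [← Fintype.sum_prod_type', ← (finCongr (pow_succ k d)).symm.sum_comp,
    ← finProdFinEquiv.sum_comp]
  refine Finset.sum_congr rfl fun p _ => ?_
  simp [finProdFinEquiv, add_comm, mul_comm]

/-- At every depth, the values of a consistent vector add up to its value at the root. -/
lemma Consistent.sum_depth {k ℓ : ℕ} {t : TreeNode k ℓ → ℝ} (ht : Consistent t) (d : ℕ)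
    (hd : d < ℓ) :
    ∑ j : Fin (k ^ d), t (mkNode d hd j) = t (mkNode 0 (by omega) ⟨0, by simp⟩) := by
  induction d with
  | zero =>
    have : Subsingleton (Fin (k ^ 0)) := by rw [pow_zero]; infer_instance
    exact Fintype.sum_subsingleton _ _
  | succ d ih =>
    rw [← ih (by omega)]
    have h := sum_fin_pow_succ (k := k) (d := d)
      fun i => if hi : i < k ^ (d + 1) then t (mkNode (d + 1) hd ⟨i, hi⟩) else 0
    simp only [Fin.is_lt, dif_pos] at h
    rw [h]
    refine Finset.sum_congr rfl fun j _ => ?_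
    rw [ht d hd j]
    refine Finset.sum_congr rfl fun r _ => ?_
    have hlt : (j : ℕ) * k + r < k ^ (d + 1) := (childNode d hd j r).2.isLt
    rw [dif_pos hlt]
    rfl

lemma sum_ite_eq_mul_add {k : ℕ} (a j : ℕ) (hk : 0 < k) (y : ℝ) :
    ∑ r : Fin k, (if a = j * k + r then y else 0) = if a / k = j then y else 0 := by
  split_ifs with h
  · subst h
    rw [Finset.sum_eq_single ⟨a % k, Nat.mod_lt _ hk⟩]
    · rw [if_pos (Nat.div_add_mod' a k).symm]
    · intro r _ hr
      refine if_neg fun h => hr (Fin.ext ?_)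
      have := Nat.div_add_mod' a k
      simp only
      omega
    · simp
  · refine Finset.sum_eq_zero fun r _ => if_neg fun h' => h ?_
    rw [h', mul_comm, Nat.mul_add_div hk, Nat.div_eq_of_lt r.isLt, add_zero]

lemma div_pow_sub_succ_div {k n d : ℕ} (u : ℕ) (hd : d < n) :
    u / k ^ (n - (d + 1)) / k = u / k ^ (n - d) := by
  rw [Nat.div_div_eq_div_mul, ← pow_succ]
  congr 2
  omega

lemma Hfun_eq_sum_ite {k ℓ : ℕ} (x : Fin (k ^ (ℓ - 1)) → ℝ) (v : TreeNode k ℓ) :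
    Hfun x v = ∑ u : Fin (k ^ (ℓ - 1)),
      if (u : ℕ) / k ^ (ℓ - 1 - (v.1 : ℕ)) = (v.2 : ℕ) then x u else 0 :=
  Finset.sum_filter _ _

lemma consistent_Hfun {k ℓ : ℕ} (hk : 0 < k) (x : Fin (k ^ (ℓ - 1)) → ℝ) :
    Consistent (Hfun x) := by
  intro d hd j
  simp only [Hfun_eq_sum_ite, mkNode, childNode]
  rw [Finset.sum_comm]
  refine Finset.sum_congr rfl fun u _ => ?_
  rw [sum_ite_eq_mul_add _ _ hk, div_pow_sub_succ_div _ (by omega)]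

lemma Hfun_leaf {k ℓ : ℕ} (hℓ : 0 < ℓ) (x : Fin (k ^ (ℓ - 1)) → ℝ) (u : Fin (k ^ (ℓ - 1))) :
    Hfun x (mkNode (ℓ - 1) (by omega) u) = x u := by
  have : subtreeLeaves (k := k) (ℓ := ℓ) (mkNode (ℓ - 1) (by omega) u) = {u} := by
    ext w
    simp [subtreeLeaves, mkNode, Fin.ext_iff]
  rw [Hfun, this, Finset.sum_singleton]

/-- The residual of a closest consistent vector is orthogonal to all consistent vectors. -/
lemma sum_residual_mul_eq_zero {k ℓ : ℕ} {w g t : TreeNode k ℓ → ℝ} (hw : Consistent w)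
    (hmin : ∀ t, Consistent t → ∑ v, (w v - g v) ^ 2 ≤ ∑ v, (t v - g v) ^ 2)
    (ht : Consistent t) : ∑ v, (w v - g v) * t v = 0 := by
  set B := ∑ v, (w v - g v) * t v with hB
  set A := ∑ v, t v ^ 2 with hA
  have hA0 : 0 ≤ A := Finset.sum_nonneg fun v _ => sq_nonneg _
  have key : ∀ s : ℝ, 0 ≤ 2 * s * B + s ^ 2 * A := by
    intro s
    have hc : Consistent fun v => w v + s * t v := by
      intro d hd j
      simp only
      rw [hw d hd j, ht d hd j, Finset.sum_add_distrib, Finset.mul_sum]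
    have h := hmin _ hc
    have he : ∑ v, (w v + s * t v - g v) ^ 2
        = ∑ v, (w v - g v) ^ 2 + (2 * s * B + s ^ 2 * A) := by
      rw [hB, hA, Finset.mul_sum, Finset.mul_sum, ← Finset.sum_add_distrib,
        ← Finset.sum_add_distrib]
      exact Finset.sum_congr rfl fun v _ => by ring
    linarith
  have h := key (-B / (A + 1))
  have he : 2 * (-B / (A + 1)) * B + (-B / (A + 1)) ^ 2 * A
      = -(B ^ 2 * (A + 2)) / (A + 1) ^ 2 := by
    field_simp
    ring
  rw [he, le_div_iff₀ (by positivity)] at h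
  have : B ^ 2 = 0 := by nlinarith [sq_nonneg B, mul_nonneg (sq_nonneg B) hA0]
  simpa using this

/-- The constrained estimate of all leaves but two is unbiased, with error a linear form in the
noise whose coefficient vector has squared norm at most `3`. -/
lemma exists_sum_hbar_sub_eq_linear {k ℓ : ℕ} (hk : 0 < k) (hℓ : 1 < ℓ)
    (x : Fin (k ^ (ℓ - 1)) → ℝ) (hbar : (TreeNode k ℓ → ℝ) → TreeNode k ℓ → ℝ)
    (hbar_cons : ∀ g, Consistent (hbar g))
    (hbar_min : ∀ g t, Consistent t → ∑ v, (hbar g v - g v) ^ 2 ≤ ∑ v, (t v - g v) ^ 2)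
    {p q : Fin (k ^ (ℓ - 1))} (hpq : p ≠ q) :
    ∃ c : TreeNode k ℓ → ℝ, ∑ v, c v ^ 2 ≤ 3 ∧ ∀ ω : TreeNode k ℓ → ℝ,
      (∑ u ∈ Finset.univ \ {p, q}, hbar (fun w => Hfun x w + ω w) (mkNode (ℓ - 1) (by omega) u))
        - ∑ u ∈ Finset.univ \ {p, q}, x u = ∑ v, c v * ω v := by
  let root : TreeNode k ℓ := mkNode 0 (by omega) ⟨0, by simp⟩
  let leaf : Fin (k ^ (ℓ - 1)) → TreeNode k ℓ := mkNode (ℓ - 1) (by omega)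
  have hroot : ∀ u, root ≠ leaf u := fun u h => by
    have := congrArg (fun v : TreeNode k ℓ => (v.1 : ℕ)) h
    simp only [root, leaf, mkNode] at this
    omega
  have hleaf : leaf p ≠ leaf q := fun h => hpq <| by
    simpa [leaf, mkNode] using h
  let a : TreeNode k ℓ → ℝ := fun v =>
    (if v = root then 1 else 0) - (if v = leaf p then 1 else 0) - (if v = leaf q then 1 else 0)
  have ha : ∀ t : TreeNode k ℓ → ℝ, ∑ v, a v * t v = t root - t (leaf p) - t (leaf q) := by
    intro t
    simp only [a, sub_mul, Finset.sum_sub_distrib, ite_mul, one_mul, zero_mul,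
      Finset.sum_ite_eq', Finset.mem_univ, if_true]
  have haa : ∑ v, a v * a v = 3 := by
    rw [ha]
    simp only [a, if_true, if_neg (hroot _), if_neg (hroot _).symm, if_neg hleaf,
      if_neg hleaf.symm]
    norm_num
  have hq : ∀ t : TreeNode k ℓ → ℝ, Consistent t →
      ∑ u ∈ Finset.univ \ {p, q}, t (leaf u) = ∑ v, a v * t v := by
    intro t ht
    have h1 := Finset.sum_sdiff (Finset.subset_univ ({p, q} : Finset (Fin (k ^ (ℓ - 1)))))
      (f := fun u => t (leaf u))
    have h2 : ∑ u, t (leaf u) = t root := ht.sum_depth _ _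
    rw [Finset.sum_pair hpq, h2] at h1
    rw [ha]
    linarith
  have hproj : ∀ g t, Consistent t → ∑ v, hbar g v * t v = ∑ v, g v * t v := by
    intro g t ht
    have := sum_residual_mul_eq_zero (hbar_cons g) (hbar_min g) ht
    simp only [sub_mul, Finset.sum_sub_distrib] at this
    linarith
  have hcomm : ∀ f g : TreeNode k ℓ → ℝ, ∑ v, f v * g v = ∑ v, g v * f v :=
    fun f g => Finset.sum_congr rfl fun v _ => mul_comm _ _
  refine ⟨hbar a, ?_, fun ω => ?_⟩
  · have h1 := hproj a (hbar a) (hbar_cons a)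
    have h2 : 0 ≤ ∑ v, (a v - hbar a v) ^ 2 := Finset.sum_nonneg fun v _ => sq_nonneg _
    have h3 : ∑ v, (a v - hbar a v) ^ 2
        = ∑ v, a v * a v - 2 * ∑ v, a v * hbar a v + ∑ v, hbar a v * hbar a v := by
      rw [Finset.mul_sum, ← Finset.sum_sub_distrib, ← Finset.sum_add_distrib]
      exact Finset.sum_congr rfl fun v _ => by ring
    simp only [sq] at h2 h3 ⊢
    linarith
  · set g : TreeNode k ℓ → ℝ := fun w => Hfun x w + ω w with hg
    have hH := consistent_Hfun hk x
    have hx : ∑ u ∈ Finset.univ \ {p, q}, x u = ∑ v, a v * Hfun x v := by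
      rw [← hq _ hH]
      exact Finset.sum_congr rfl fun u _ => (Hfun_leaf (by omega) x u).symm
    rw [hx, hq _ (hbar_cons g), ← hproj a _ (hbar_cons g), ← hproj a _ hH,
      hcomm, hproj g _ (hbar_cons a), hcomm, ← Finset.sum_sub_distrib]
    exact Finset.sum_congr rfl fun v _ => by simp only [hg]; ring

/-- The node with index `j` at depth `d` is the leftmost or the rightmost one at its depth. -/
def IsExtremeIndex (k d j : ℕ) : Prop := j = 0 ∨ j + 1 = k ^ d

instance (k d j : ℕ) : Decidable (IsExtremeIndex k d j) :=
  inferInstanceAs (Decidable (_ ∨ _))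

lemma IsExtremeIndex.div {k d j : ℕ} (hk : 0 < k) (h : IsExtremeIndex k (d + 1) j) :
    IsExtremeIndex k d (j / k) := by
  rcases h with h | h
  · exact Or.inl (by simp [h])
  · refine Or.inr ?_
    have hd : 0 < k ^ d := pow_pos hk d
    have : j = k * (k ^ d - 1) + (k - 1) := by
      obtain ⟨m, hm⟩ : ∃ m, k ^ d = m + 1 := ⟨k ^ d - 1, by omega⟩
      rw [pow_succ, hm] at h
      rw [hm, Nat.add_sub_cancel]
      have : (m + 1) * k = k * m + k := by ring
      omega
    rw [this, Nat.mul_add_div hk, Nat.div_eq_of_lt (by omega)]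
    omega

lemma IsExtremeIndex.ancestor {k n d e u : ℕ} (hk : 0 < k) (hde : d ≤ e) (hen : e ≤ n)
    (h : IsExtremeIndex k e (u / k ^ (n - e))) : IsExtremeIndex k d (u / k ^ (n - d)) := by
  induction e, hde using Nat.le_induction with
  | base => exact h
  | succ e hde ih =>
    refine ih (by omega) ?_
    rw [← div_pow_sub_succ_div u (by omega)]
    exact h.div hk

lemma div_pow_sub_eq_of_le {k n d e u w : ℕ} (hde : d ≤ e) (hen : e ≤ n)
    (h : u / k ^ (n - e) = w / k ^ (n - e)) : u / k ^ (n - d) = w / k ^ (n - d) := by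
  have : k ^ (n - d) = k ^ (n - e) * k ^ (e - d) := by
    rw [← pow_add]
    congr 1
    omega
  rw [this, ← Nat.div_div_eq_div_mul, h, Nat.div_div_eq_div_mul]

lemma mem_subtreeLeaves {k ℓ : ℕ} {v : TreeNode k ℓ} {u : Fin (k ^ (ℓ - 1))} :
    u ∈ subtreeLeaves v ↔ (u : ℕ) / k ^ (ℓ - 1 - (v.1 : ℕ)) = (v.2 : ℕ) := by
  simp [subtreeLeaves]

lemma treeNode_ext {k ℓ : ℕ} {v w : TreeNode k ℓ} (h1 : (v.1 : ℕ) = w.1)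
    (h2 : (v.2 : ℕ) = w.2) : v = w := by
  obtain ⟨⟨d, hd⟩, ⟨i, hi⟩⟩ := v
  obtain ⟨⟨e, he⟩, ⟨j, hj⟩⟩ := w
  simp only at h1 h2
  subst h1 h2
  rfl

lemma subtreeLeaves_nonempty {k ℓ : ℕ} (hk : 0 < k) (v : TreeNode k ℓ) :
    (subtreeLeaves v).Nonempty := by
  have hp : 0 < k ^ (ℓ - 1 - (v.1 : ℕ)) := pow_pos hk _
  have hlt : (v.2 : ℕ) * k ^ (ℓ - 1 - (v.1 : ℕ)) < k ^ (ℓ - 1) := by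
    have hd := v.1.isLt
    calc (v.2 : ℕ) * k ^ (ℓ - 1 - (v.1 : ℕ)) < k ^ (v.1 : ℕ) * k ^ (ℓ - 1 - (v.1 : ℕ)) :=
          Nat.mul_lt_mul_of_pos_right v.2.isLt hp
      _ = k ^ (ℓ - 1) := by
          rw [← pow_add]
          congr 1
          omega
  exact ⟨⟨_, hlt⟩, mem_subtreeLeaves.2 (Nat.mul_div_cancel _ hp)⟩

/-- An extreme node has an extreme leaf below it. -/
lemma exists_extreme_mem_subtreeLeaves {k ℓ : ℕ} (hk : 0 < k) {v : TreeNode k ℓ}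
    (hv : IsExtremeIndex k v.1 v.2) :
    ∃ u ∈ subtreeLeaves v, IsExtremeIndex k (ℓ - 1) (u : ℕ) := by
  have hn : 0 < k ^ (ℓ - 1) := pow_pos hk _
  have hp : 0 < k ^ (ℓ - 1 - (v.1 : ℕ)) := pow_pos hk _
  rcases hv with h | h
  · exact ⟨⟨0, hn⟩, mem_subtreeLeaves.2 (by simp [h]), Or.inl rfl⟩
  · refine ⟨⟨k ^ (ℓ - 1) - 1, by omega⟩, mem_subtreeLeaves.2 ?_, Or.inr (by simp only; omega)⟩
    have hd := v.1.isLt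
    have hpow : k ^ (ℓ - 1) = k ^ (ℓ - 1 - (v.1 : ℕ)) * ((v.2 : ℕ) + 1) := by
      rw [h, ← pow_add]
      congr 1
      omega
    have : k ^ (ℓ - 1) - 1
        = k ^ (ℓ - 1 - (v.1 : ℕ)) * (v.2 : ℕ) + (k ^ (ℓ - 1 - (v.1 : ℕ)) - 1) := by
      rw [hpow, mul_add, mul_one]
      omega
    simp only
    rw [this, Nat.mul_add_div hp, Nat.div_eq_of_lt (by omega), add_zero]

/-- The nodes that are not extreme but whose parent is. -/
def canonicalCover (k ℓ : ℕ) : Finset (TreeNode k ℓ) :=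
  Finset.univ.filter fun v =>
    ¬ IsExtremeIndex k v.1 v.2 ∧ IsExtremeIndex k ((v.1 : ℕ) - 1) ((v.2 : ℕ) / k)

lemma mem_canonicalCover {k ℓ : ℕ} {v : TreeNode k ℓ} : v ∈ canonicalCover k ℓ ↔
    ¬ IsExtremeIndex k v.1 v.2 ∧ IsExtremeIndex k ((v.1 : ℕ) - 1) ((v.2 : ℕ) / k) := by
  simp [canonicalCover]

lemma depth_pos_of_not_isExtremeIndex {k ℓ : ℕ} {v : TreeNode k ℓ}
    (hv : ¬ IsExtremeIndex k v.1 v.2) : 0 < (v.1 : ℕ) := by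
  obtain ⟨⟨d, hd⟩, ⟨j, hj⟩⟩ := v
  rcases Nat.eq_zero_or_pos d with rfl | h
  · exact absurd (Or.inl (by simpa using hj)) hv
  · exact h

/-- Below a node of the canonical cover, ancestors strictly above it are extreme. -/
lemma isExtremeIndex_of_lt_depth {k ℓ : ℕ} (hk : 0 < k) {v : TreeNode k ℓ}
    (hv : v ∈ canonicalCover k ℓ) {u : Fin (k ^ (ℓ - 1))} (hu : u ∈ subtreeLeaves v) {d : ℕ}
    (hd : d < v.1) : IsExtremeIndex k d ((u : ℕ) / k ^ (ℓ - 1 - d)) := by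
  have hlt := v.1.isLt
  refine IsExtremeIndex.ancestor (e := (v.1 : ℕ) - 1) hk (by omega) (by omega) ?_
  rw [← div_pow_sub_succ_div _ (by omega), Nat.sub_add_cancel (by omega),
    mem_subtreeLeaves.1 hu]
  exact (mem_canonicalCover.1 hv).2

lemma eq_of_mem_canonicalCover {k ℓ : ℕ} (hk : 0 < k) {v w : TreeNode k ℓ}
    (hv : v ∈ canonicalCover k ℓ) (hw : w ∈ canonicalCover k ℓ) {u : Fin (k ^ (ℓ - 1))}
    (huv : u ∈ subtreeLeaves v) (huw : u ∈ subtreeLeaves w) : v = w := by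
  have hle : ∀ {v w : TreeNode k ℓ}, v ∈ canonicalCover k ℓ → w ∈ canonicalCover k ℓ →
      u ∈ subtreeLeaves v → u ∈ subtreeLeaves w → (v.1 : ℕ) ≤ w.1 := by
    intro v w hv hw huv huw
    by_contra! hlt
    have := isExtremeIndex_of_lt_depth hk hv huv hlt
    rw [mem_subtreeLeaves.1 huw] at this
    exact (mem_canonicalCover.1 hw).1 this
  have hd : (v.1 : ℕ) = w.1 := (hle hv hw huv huw).antisymm (hle hw hv huw huv)
  refine treeNode_ext hd ?_
  rw [← mem_subtreeLeaves.1 huv, ← mem_subtreeLeaves.1 huw, hd]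

lemma exists_mem_canonicalCover_iff {k ℓ : ℕ} (hk : 0 < k) (hℓ : 0 < ℓ)
    (u : Fin (k ^ (ℓ - 1))) :
    (∃ v ∈ canonicalCover k ℓ, u ∈ subtreeLeaves v) ↔ ¬ IsExtremeIndex k (ℓ - 1) (u : ℕ) := by
  constructor
  · rintro ⟨v, hv, hu⟩ h
    have hlt := v.1.isLt
    have := IsExtremeIndex.ancestor (n := ℓ - 1) (u := u) hk (show (v.1 : ℕ) ≤ ℓ - 1 by omega)
      le_rfl (by simpa using h)
    rw [mem_subtreeLeaves.1 hu] at this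
    exact (mem_canonicalCover.1 hv).1 this
  · intro h
    have hex : ∃ d, ¬ IsExtremeIndex k d ((u : ℕ) / k ^ (ℓ - 1 - d)) := ⟨ℓ - 1, by simpa using h⟩
    classical
    obtain ⟨d, hd⟩ : ∃ d, d = Nat.find hex := ⟨_, rfl⟩
    have hspec : ¬ IsExtremeIndex k d ((u : ℕ) / k ^ (ℓ - 1 - d)) := hd ▸ Nat.find_spec hex
    have hdle : d ≤ ℓ - 1 := hd ▸ Nat.find_min' hex (by simpa using h)
    have hlt : (u : ℕ) / k ^ (ℓ - 1 - d) < k ^ d := by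
      rw [Nat.div_lt_iff_lt_mul (pow_pos hk _), ← pow_add, Nat.add_sub_cancel' hdle]
      exact u.isLt
    have hpos := depth_pos_of_not_isExtremeIndex
      (v := (⟨⟨d, by omega⟩, ⟨_, hlt⟩⟩ : TreeNode k ℓ)) hspec
    simp only at hpos
    refine ⟨⟨⟨d, by omega⟩, ⟨_, hlt⟩⟩, mem_canonicalCover.2 ⟨hspec, ?_⟩, mem_subtreeLeaves.2 rfl⟩
    obtain ⟨e, rfl⟩ : ∃ e, d = e + 1 := ⟨d - 1, by omega⟩
    simp only [Nat.add_sub_cancel]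
    rw [div_pow_sub_succ_div _ (by omega)]
    exact not_not.1 (Nat.find_min hex (by omega))

/-- Any family of subtrees partitioning the non-extreme leaves has at least as many members as
the canonical cover. -/
lemma card_canonicalCover_le {k ℓ : ℕ} (hk : 0 < k) (hℓ : 0 < ℓ) {C : Finset (TreeNode k ℓ)}
    (hC : ∀ u, (∃ v ∈ C, u ∈ subtreeLeaves v) ↔ ¬ IsExtremeIndex k (ℓ - 1) (u : ℕ)) :
    (canonicalCover k ℓ).card ≤ C.card := by
  have hex : ∀ c ∈ canonicalCover k ℓ, ∃ v ∈ C, ∃ u ∈ subtreeLeaves v, u ∈ subtreeLeaves c := by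
    intro c hc
    obtain ⟨u, hu⟩ := subtreeLeaves_nonempty hk c
    obtain ⟨v, hv, huv⟩ := (hC u).2 ((exists_mem_canonicalCover_iff hk hℓ u).1 ⟨c, hc, hu⟩)
    exact ⟨v, hv, u, huv, hu⟩
  have : Nonempty (Fin (k ^ (ℓ - 1))) := ⟨⟨0, pow_pos hk _⟩⟩
  choose! f hf a haf hac using hex
  refine Finset.card_le_card_of_injOn f hf fun c hc c' hc' hcc' => ?_
  have hdepth : (c.1 : ℕ) ≤ (f c).1 := by
    by_contra! hlt
    have := isExtremeIndex_of_lt_depth hk hc (hac c hc) hlt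
    rw [mem_subtreeLeaves.1 (haf c hc)] at this
    obtain ⟨u, hu, hext⟩ := exists_extreme_mem_subtreeLeaves hk this
    exact (hC u).1 ⟨_, hf c hc, hu⟩ hext
  refine eq_of_mem_canonicalCover hk hc hc' (u := a c') ?_ (hac c' hc')
  have hlt := (f c).1.isLt
  have h := mem_subtreeLeaves.1 (haf c' hc')
  rw [← hcc', ← mem_subtreeLeaves.1 (haf c hc)] at h
  rw [mem_subtreeLeaves, ← mem_subtreeLeaves.1 (hac c hc)]
  exact div_pow_sub_eq_of_le hdepth (by omega) h

/-- The number of nodes of the canonical cover at depth `d`. -/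
lemma card_filter_canonicalCover_depth {k : ℕ} (hk : 2 ≤ k) (d : ℕ) :
    ((Finset.range (k ^ d)).filter fun j =>
      ¬ IsExtremeIndex k d j ∧ IsExtremeIndex k (d - 1) (j / k)).card
      = if d = 0 then 0 else if d = 1 then k - 2 else 2 * (k - 1) := by
  rcases d with _ | _ | d
  · simp [Finset.filter_eq_empty_iff, IsExtremeIndex]
  · have : ((Finset.range (k ^ (0 + 1))).filter fun j =>
        ¬ IsExtremeIndex k (0 + 1) j ∧ IsExtremeIndex k (0 + 1 - 1) (j / k))
        = Finset.Ico 1 (k - 1) := by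
      ext j
      simp only [IsExtremeIndex, Finset.mem_filter, Finset.mem_range, Finset.mem_Ico,
        zero_add, pow_one, Nat.sub_self, pow_zero]
      constructor
      · omega
      · intro h
        exact ⟨by omega, by omega, Or.inl (Nat.div_eq_of_lt (by omega))⟩
    rw [this, Nat.card_Ico]
    simp
    omega
  · have hm : 2 ≤ k ^ (d + 1) := hk.trans (Nat.le_self_pow (by omega) k)
    have hmk : k ^ (d + 1 + 1) = (k ^ (d + 1) - 1) * k + k := by
      rw [pow_succ _ (d + 1)]
      obtain ⟨m, hm⟩ : ∃ m, k ^ (d + 1) = m + 1 := ⟨k ^ (d + 1) - 1, by omega⟩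
      rw [hm, Nat.add_sub_cancel]
      ring
    have hkm : k ≤ (k ^ (d + 1) - 1) * k := Nat.le_mul_of_pos_left k (by omega)
    set m := k ^ (d + 1) - 1 with hmdef
    have : ((Finset.range (k ^ (d + 1 + 1))).filter fun j =>
        ¬ IsExtremeIndex k (d + 1 + 1) j ∧ IsExtremeIndex k (d + 1 + 1 - 1) (j / k))
        = Finset.Ico 1 k ∪ Finset.Ico (m * k) (m * k + (k - 1)) := by
      ext j
      simp only [IsExtremeIndex, Finset.mem_filter, Finset.mem_range, Finset.mem_Ico,
        Finset.mem_union, Nat.add_sub_cancel, hmk]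
      have h0 : j / k = 0 ↔ j < k := by
        rw [Nat.div_eq_zero_iff]
        omega
      have h1 : j / k + 1 = k ^ (d + 1) ↔ m * k ≤ j ∧ j < m * k + k := by
        rw [show j / k + 1 = k ^ (d + 1) ↔ j / k = m by omega, Nat.div_eq_iff (by omega)]
        omega
      rw [h0, h1]
      omega
    rw [this, Finset.card_union_of_disjoint, Nat.card_Ico, Nat.card_Ico]
    · simp
      omega
    · rw [Finset.disjoint_left]
      intro j hj hj'
      simp only [Finset.mem_Ico] at hj hj'
      omega

lemma card_canonicalCover {k ℓ : ℕ} (hk : 2 ≤ k) (hℓ : 2 ≤ ℓ) :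
    (canonicalCover k ℓ).card = 2 * (k - 1) * (ℓ - 1) - k := by
  have hdepth : ∀ d : ℕ, (∑ j : Fin (k ^ d),
      if ¬ IsExtremeIndex k d j ∧ IsExtremeIndex k (d - 1) ((j : ℕ) / k) then 1 else 0)
      = if d = 0 then 0 else if d = 1 then k - 2 else 2 * (k - 1) := by
    intro d
    rw [← card_filter_canonicalCover_depth hk d, Finset.card_filter, Finset.sum_range]
  rw [canonicalCover, Finset.card_filter, Fintype.sum_sigma]
  simp only [hdepth]
  rw [← Finset.sum_range fun d => if d = 0 then 0 else if d = 1 then k - 2 else 2 * (k - 1)]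
  obtain ⟨m, rfl⟩ : ∃ m, ℓ = m + 2 := ⟨ℓ - 2, by omega⟩
  rw [Finset.sum_range_succ', Finset.sum_range_succ']
  simp only [Nat.add_eq_zero_iff, one_ne_zero, and_false, if_false, zero_add, if_true,
    Nat.reduceEqDiff, Finset.sum_const, Finset.card_range, smul_eq_mul]
  obtain ⟨i, rfl⟩ : ∃ i, k = i + 2 := ⟨k - 2, by omega⟩
  have h1 : i + 2 - 1 = i + 1 := by omega
  have h2 : m + 2 - 1 = m + 1 := by omega
  rw [h1, h2]
  have : 2 * (i + 1) * (m + 1) = m * (2 * (i + 1)) + i + (i + 2) := by ring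
  omega

/-- **Constrained inference beats the subtree-sum estimate on some range query.**
Take the range query `q` summing all leaves except the leftmost and rightmost ones,
with noisy counts `h̃ = H(x) + η`, `η` i.i.d. `Laplace(ℓ/ε)`.  Then
`E[(h̄_q − q(x))²] ≤ 6ℓ²/ε²`, while for any minimal collection `C` of disjoint subtrees
whose leaf intervals partition the query range, the subtree-sum estimate
`H̃_q = Σ_{v ∈ C} h̃[v]` has `E[(H̃_q − q(x))²] = 2(2(k−1)(ℓ−1) − k)·ℓ²/ε²`; hence
`E[(h̄_q − q(x))²] ≤ (3/(2(ℓ−1)(k−1) − k))·E[(H̃_q − q(x))²]`. -/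
theorem tree_inference_beats_subtree_sum (k ℓ : ℕ) (hk : 2 ≤ k) (hℓ : 2 ≤ ℓ)
    (hkl : 0 < 2 * (ℓ - 1) * (k - 1) - k)
    (ε : ℝ) (hε : 0 < ε)
    (x : Fin (k ^ (ℓ - 1)) → ℝ)
    (hbar : (TreeNode k ℓ → ℝ) → TreeNode k ℓ → ℝ)
    (hbar_cons : ∀ g, Consistent (hbar g))
    (hbar_min : ∀ g t, Consistent t → ∑ v, (hbar g v - g v) ^ 2 ≤ ∑ v, (t v - g v) ^ 2)
    (R : Finset (Fin (k ^ (ℓ - 1))))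
    (hR : R = Finset.univ \
      {(⟨0, pow_pos (by omega) _⟩ : Fin (k ^ (ℓ - 1))),
       ⟨k ^ (ℓ - 1) - 1, by have := pow_pos (show 0 < k by omega) (ℓ - 1); omega⟩}) :
    (∫ ω, ((∑ u ∈ R, hbar (fun w => Hfun x w + ω w) (mkNode (ℓ - 1) (by omega) u))
        - ∑ u ∈ R, x u) ^ 2 ∂(treeNoise k ℓ ((ℓ : ℝ) / ε)))
      ≤ 6 * (ℓ : ℝ) ^ 2 / ε ^ 2
    ∧ ∀ C : Finset (TreeNode k ℓ),
        (∀ v ∈ C, ∀ w ∈ C, v ≠ w → Disjoint (subtreeLeaves v) (subtreeLeaves w)) →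
        C.biUnion subtreeLeaves = R →
        (∀ C' : Finset (TreeNode k ℓ),
          (∀ v ∈ C', ∀ w ∈ C', v ≠ w → Disjoint (subtreeLeaves v) (subtreeLeaves w)) →
          C'.biUnion subtreeLeaves = R → C.card ≤ C'.card) →
        (∫ ω, ((∑ v ∈ C, (Hfun x v + ω v)) - ∑ u ∈ R, x u) ^ 2
            ∂(treeNoise k ℓ ((ℓ : ℝ) / ε)))
          = 2 * ((2 * (k - 1) * (ℓ - 1) - k : ℕ) : ℝ) * (ℓ : ℝ) ^ 2 / ε ^ 2
        ∧ (∫ ω, ((∑ u ∈ R, hbar (fun w => Hfun x w + ω w) (mkNode (ℓ - 1) (by omega) u))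
              - ∑ u ∈ R, x u) ^ 2 ∂(treeNoise k ℓ ((ℓ : ℝ) / ε)))
            ≤ (3 / ((2 * (ℓ - 1) * (k - 1) - k : ℕ) : ℝ))
              * ∫ ω, ((∑ v ∈ C, (Hfun x v + ω v)) - ∑ u ∈ R, x u) ^ 2
                  ∂(treeNoise k ℓ ((ℓ : ℝ) / ε)) := by
  have hk0 : 0 < k := by omega
  have hn : 2 ≤ k ^ (ℓ - 1) := hk.trans (Nat.le_self_pow (by omega) k)
  have hb : 0 < (ℓ : ℝ) / ε := div_pos (by exact_mod_cast (by omega : 0 < ℓ)) hε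
  have hinf : (∫ ω, ((∑ u ∈ R, hbar (fun w => Hfun x w + ω w) (mkNode (ℓ - 1) (by omega) u))
      - ∑ u ∈ R, x u) ^ 2 ∂(treeNoise k ℓ ((ℓ : ℝ) / ε))) ≤ 6 * (ℓ : ℝ) ^ 2 / ε ^ 2 := by
    obtain ⟨c, hc, hlin⟩ := exists_sum_hbar_sub_eq_linear hk0 hℓ x hbar hbar_cons hbar_min
      (p := ⟨0, pow_pos hk0 _⟩) (q := ⟨k ^ (ℓ - 1) - 1, by omega⟩)
      (by rw [Ne, Fin.mk.injEq]; omega)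
    subst hR
    simp only [hlin]
    rw [integral_sq_linear_treeNoise hb]
    calc 2 * ((ℓ : ℝ) / ε) ^ 2 * ∑ v, c v ^ 2 ≤ 2 * ((ℓ : ℝ) / ε) ^ 2 * 3 := by gcongr
      _ = 6 * (ℓ : ℝ) ^ 2 / ε ^ 2 := by ring
  refine ⟨hinf, fun C hdisj hunion hmin => ?_⟩
  have hmemR : ∀ u, u ∈ R ↔ ¬ IsExtremeIndex k (ℓ - 1) (u : ℕ) := by
    intro u
    simp only [hR, IsExtremeIndex, Finset.mem_sdiff, Finset.mem_univ, true_and,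
      Finset.mem_insert, Finset.mem_singleton, Fin.ext_iff]
    omega
  have hcard : C.card = 2 * (k - 1) * (ℓ - 1) - k := by
    rw [← card_canonicalCover hk hℓ]
    refine le_antisymm (hmin _ ?_ ?_) (card_canonicalCover_le hk0 (by omega) fun u => ?_)
    · intro v hv w hw hvw
      rw [Finset.disjoint_left]
      exact fun u huv huw => hvw (eq_of_mem_canonicalCover hk0 hv hw huv huw)
    · ext u
      rw [Finset.mem_biUnion, exists_mem_canonicalCover_iff hk0 (by omega), hmemR]
    · rw [← Finset.mem_biUnion, hunion, hmemR]
  have hsub : (∫ ω, ((∑ v ∈ C, (Hfun x v + ω v)) - ∑ u ∈ R, x u) ^ 2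
      ∂(treeNoise k ℓ ((ℓ : ℝ) / ε)))
      = 2 * ((2 * (k - 1) * (ℓ - 1) - k : ℕ) : ℝ) * (ℓ : ℝ) ^ 2 / ε ^ 2 := by
    have hlin : ∀ ω : TreeNode k ℓ → ℝ, (∑ v ∈ C, (Hfun x v + ω v)) - ∑ u ∈ R, x u
        = ∑ v, (if v ∈ C then 1 else 0) * ω v := by
      intro ω
      rw [Finset.sum_add_distrib, ← hunion, Finset.sum_biUnion hdisj]
      simp [Hfun]
    simp only [hlin]
    rw [integral_sq_linear_treeNoise hb, ← hcard]
    simp only [ite_pow, one_pow, ne_eq, OfNat.ofNat_ne_zero, not_false_eq_true, zero_pow,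
      Finset.sum_boole, Finset.filter_univ_mem]
    ring
  refine ⟨hsub, ?_⟩
  rw [hsub, mul_right_comm 2 (ℓ - 1) (k - 1)]
  rw [mul_right_comm 2 (ℓ - 1) (k - 1)] at hkl
  have hm : (0 : ℝ) < ((2 * (k - 1) * (ℓ - 1) - k : ℕ) : ℝ) := by exact_mod_cast hkl
  refine hinf.trans (le_of_eq ?_)
  field_simp
  norm_num
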